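/- arXiv:2404.07231 — 2 statements merged into one kernel-verified Lean document; each statement's English description precedes it below -/
import Mathlib

section
/- Let G be a vertex-transitive finite graph on N nodes and \bar{G} its complement. Then \vartheta(G) \cdot \vartheta(\bar{G}) = N, where \vartheta denotes the Lovász theta function. -/
open Matrix

/-- The largest eigenvalue of a real symmetric matrix, via the Rayleigh quotient. -/
noncomputable def lambdaMax {V : Type*} [Fintype V] (B : Matrix V V ℝ) : ℝ :=
  sSup {r : ℝ | ∃ x : V → ℝ, (∑ i, (x i) ^ 2) = 1 ∧ r = x ⬝ᵥ B.mulVec x}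

/-- The Lovász theta function of a finite graph: the maximum largest eigenvalue of a
real symmetric PSD matrix with unit diagonal vanishing on the edges of `G`. -/
noncomputable def lovaszTheta {V : Type*} [Fintype V] (G : SimpleGraph V) : ℝ :=
  sSup {t : ℝ | ∃ B : Matrix V V ℝ, B.IsSymm ∧ B.PosSemidef ∧
    (∀ i, B i i = 1) ∧ (∀ i j, G.Adj i j → B i j = 0) ∧ t = lambdaMax B}

/-- quadratic form -/
def qf {V : Type*} [Fintype V] (B : Matrix V V ℝ) (x : V → ℝ) : ℝ :=
  ∑ i, ∑ j, x i * x j * B i j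

lemma qf_eq {V : Type*} [Fintype V] (B : Matrix V V ℝ) (x : V → ℝ) :
    x ⬝ᵥ B.mulVec x = qf B x := by
  simp only [qf, dotProduct, mulVec, Finset.mul_sum]
  refine Finset.sum_congr rfl fun i _ => Finset.sum_congr rfl fun j _ => by ring

lemma psd_iff {V : Type*} [Fintype V] (B : Matrix V V ℝ) :
    B.PosSemidef ↔ (∀ i j, B i j = B j i) ∧ ∀ x, 0 ≤ qf B x := by
  rw [posSemidef_iff_dotProduct_mulVec]
  simp only [star_trivial, qf_eq]
  refine and_congr ⟨fun h i j => ?_, fun h => ?_⟩ Iff.rfl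
  · simpa using (h.apply j i)
  · ext i j
    simpa using h j i

lemma entry_le {V : Type*} [Fintype V] {B : Matrix V V ℝ} (hB : B.PosSemidef) (i j : V) :
    2 * |B i j| ≤ B i i + B j j := by
  classical
  obtain ⟨hs, hq⟩ := (psd_iff B).1 hB
  by_cases hij : i = j
  · subst hij
    rw [abs_of_nonneg hB.diag_nonneg]; linarith
  have key : ∀ s : ℝ, qf B (Pi.single i 1 + Pi.single j s) =
      B i i + s * B i j + s * B j i + s * s * B j j := by
    intro s
    simp [qf, Pi.single_apply, add_mul, mul_add, Finset.sum_add_distrib]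
    try ring
  have h1 := hq (Pi.single i 1 + Pi.single j 1)
  have h2 := hq (Pi.single i 1 + Pi.single j (-1))
  rw [key] at h1 h2
  have := hs i j
  rcases abs_cases (B i j) with ⟨h, _⟩ | ⟨h, _⟩ <;> rw [h] <;> linarith

lemma qf_le {V : Type*} [Fintype V] {B : Matrix V V ℝ} (hB : B.PosSemidef)
    (h1 : ∀ i, B i i = 1) {x : V → ℝ} (hx : ∑ i, x i ^ 2 = 1) :
    qf B x ≤ ∑ _i : V, ∑ _j : V, (1 : ℝ) := by
  have hxi : ∀ i, |x i| ≤ 1 := fun i => by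
    rw [← sq_le_one_iff_abs_le_one, ← hx]
    exact Finset.single_le_sum (f := fun i => x i ^ 2) (fun i _ => sq_nonneg _) (Finset.mem_univ i)
  refine Finset.sum_le_sum fun i _ => Finset.sum_le_sum fun j _ => ?_
  have hb : |B i j| ≤ 1 := by have := entry_le hB i j; rw [h1, h1] at this; linarith
  calc x i * x j * B i j ≤ |x i * x j * B i j| := le_abs_self _
    _ = |x i| * |x j| * |B i j| := by rw [abs_mul, abs_mul]
    _ ≤ 1 * 1 * 1 := by
      have := hxi i; have := hxi j
      gcongr
    _ = 1 := by norm_num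

lemma lam_le {V : Type*} [Fintype V] {B : Matrix V V ℝ} {c : ℝ} (hc : 0 ≤ c)
    (h : ∀ x : V → ℝ, ∑ i, x i ^ 2 = 1 → qf B x ≤ c) : lambdaMax B ≤ c := by
  refine Real.sSup_le ?_ hc
  rintro r ⟨x, hx, rfl⟩
  rw [qf_eq]; exact h x hx

lemma theta_le {V : Type*} [Fintype V] {G : SimpleGraph V} {c : ℝ} (hc : 0 ≤ c)
    (h : ∀ B : Matrix V V ℝ, B.PosSemidef → (∀ i, B i i = 1) → (∀ i j, G.Adj i j → B i j = 0) →
      ∀ x : V → ℝ, ∑ i, x i ^ 2 = 1 → qf B x ≤ c) : lovaszTheta G ≤ c := by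
  refine Real.sSup_le ?_ hc
  rintro t ⟨B, _, hB, h1, h0, rfl⟩
  exact lam_le hc (h B hB h1 h0)

lemma le_theta {V : Type*} [Fintype V] {G : SimpleGraph V}
    {B : Matrix V V ℝ} (hB : B.PosSemidef) (h1 : ∀ i, B i i = 1)
    (h0 : ∀ i j, G.Adj i j → B i j = 0) {x : V → ℝ} (hx : ∑ i, x i ^ 2 = 1) :
    qf B x ≤ lovaszTheta G := by
  have hS : (0 : ℝ) ≤ ∑ _i : V, ∑ _j : V, (1 : ℝ) := by positivity
  calc qf B x ≤ lambdaMax B := by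
        refine le_csSup ⟨∑ _i : V, ∑ _j : V, (1 : ℝ), ?_⟩ ⟨x, hx, (qf_eq B x).symm⟩
        rintro r ⟨y, hy, rfl⟩
        rw [qf_eq]; exact qf_le hB h1 hy
    _ ≤ _ := by
        refine le_csSup ⟨∑ _i : V, ∑ _j : V, (1 : ℝ), ?_⟩ ⟨B, ?_, hB, h1, h0, rfl⟩
        · rintro t ⟨C, _, hC, hC1, _, rfl⟩
          exact lam_le hS fun y hy => qf_le hC hC1 hy
        · ext i j; exact ((psd_iff B).1 hB).1 j i

/-- averaging over the automorphism group -/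
lemma average {V : Type*} [Fintype V] [Nonempty V] {G : SimpleGraph V}
    (hvt : ∀ u v : V, ∃ e : G ≃g G, e u = v)
    {B : Matrix V V ℝ} (hB : B.PosSemidef) (htr : ∑ i, B i i = 1)
    (h0 : ∀ i j, G.Adj i j → B i j = 0) :
    ∃ C : Matrix V V ℝ, C.PosSemidef ∧ (∀ i, C i i = 1) ∧ (∀ i j, G.Adj i j → C i j = 0) ∧
      ∀ i, ∑ j, C i j = ∑ i, ∑ j, B i j := by
  classical
  haveI : Finite (G ≃g G) := Finite.of_injective (fun e : G ≃g G => (e : V → V)) DFunLike.coe_injective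
  letI : Fintype (G ≃g G) := Fintype.ofFinite _
  set n : ℝ := (Fintype.card V : ℝ) with hn
  set m : ℝ := (Fintype.card (G ≃g G) : ℝ) with hm
  have hn0 : 0 < n := by rw [hn]; exact_mod_cast Fintype.card_pos
  have hm0 : 0 < m := by rw [hm]; exact_mod_cast Fintype.card_pos
  obtain ⟨hs, hq⟩ := (psd_iff B).1 hB
  let C : Matrix V V ℝ := fun i j => (n / m) * ∑ g : G ≃g G, B (g i) (g j)
  have hinv : ∀ (h : G ≃g G) i j, C (h i) (h j) = C i j := by
    intro h i j
    simp only [C]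
    congr 1
    exact Fintype.sum_equiv (Equiv.mulRight h) _ _ fun g => rfl
  have hdiag : ∀ i k, C i i = C k k := by
    intro i k
    obtain ⟨e, rfl⟩ := hvt k i
    exact hinv e k k
  have hrow : ∀ i k, ∑ j, C i j = ∑ j, C k j := by
    intro i k
    obtain ⟨e, rfl⟩ := hvt k i
    rw [← Equiv.sum_comp e.toEquiv]
    exact Finset.sum_congr rfl fun j _ => hinv e k j
  have htrC : ∑ i, C i i = n := by
    simp only [C, ← Finset.mul_sum]
    rw [Finset.sum_comm]
    have : ∀ g : G ≃g G, ∑ i, B (g i) (g i) = 1 := fun g => by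
      rw [← htr]; exact Equiv.sum_comp g.toEquiv (fun i => B i i)
    simp only [this]
    simp only [Finset.sum_const, Finset.card_univ, nsmul_eq_mul, mul_one]
    rw [← hm]; field_simp
  have hsumC : ∑ i, ∑ j, C i j = n * ∑ i, ∑ j, B i j := by
    have e1 : ∑ i, ∑ j, C i j = (n / m) * ∑ g : G ≃g G, ∑ i, ∑ j, B (g i) (g j) := by
      simp only [C, ← Finset.mul_sum]
      congr 1
      rw [Finset.sum_comm]
      rw [Finset.sum_comm]
      simp_rw [Finset.sum_comm (s := (Finset.univ : Finset V)) (t := (Finset.univ : Finset (G ≃g G)))]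
    have : ∀ g : G ≃g G, ∑ i, ∑ j, B (g i) (g j) = ∑ i, ∑ j, B i j := fun g => by
      rw [← Equiv.sum_comp g.toEquiv (fun i => ∑ j, B i j)]
      refine Finset.sum_congr rfl fun i _ => ?_
      exact Equiv.sum_comp g.toEquiv (fun j => B (g i) j)
    rw [e1]
    simp only [this]
    simp only [Finset.sum_const, Finset.card_univ, nsmul_eq_mul]
    rw [← hm]; field_simp
  refine ⟨C, ?_, ?_, ?_, ?_⟩
  · have : C = (n / m) • ∑ g : G ≃g G, B.submatrix g g := by
      ext i j
      simp [C, Matrix.sum_apply]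
    rw [this]
    have hsum : (∑ g : G ≃g G, B.submatrix g g).PosSemidef :=
      posSemidef_sum _ fun g _ => hB.submatrix g
    have hnm : (0 : ℝ) ≤ n / m := by positivity
    exact hsum.smul hnm
  · intro i
    have : ∑ k, C k k = n * C i i := by
      rw [Finset.sum_congr rfl fun k _ => hdiag k i]
      simp [hn]
    rw [htrC] at this
    exact (mul_left_cancel₀ hn0.ne' (by linarith)).symm
  · intro i j hij
    simp only [C]
    rw [Finset.sum_eq_zero fun g _ => h0 _ _ (g.map_rel_iff.2 hij), mul_zero]
  · intro i
    have : ∑ k, ∑ j, C k j = n * ∑ j, C i j := by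
      rw [Finset.sum_congr rfl fun k _ => hrow k i]
      simp [hn]
    rw [hsumC] at this
    exact (mul_left_cancel₀ hn0.ne' (by linarith)).symm

lemma vv_psd {V : Type*} [Fintype V] (x : V → ℝ) :
    (Matrix.of fun i j => x i * x j : Matrix V V ℝ).PosSemidef := by
  have := posSemidef_vecMulVec_self_star x
  convert this using 1
  ext i j
  simp [vecMulVec_apply]

lemma scale_psd {V : Type*} [Fintype V] {B : Matrix V V ℝ} (hB : B.PosSemidef) (x : V → ℝ) :
    (Matrix.of fun i j => x i * x j * B i j : Matrix V V ℝ).PosSemidef :=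
  (vv_psd x).hadamard hB

/-- upper bound -/
lemma prod_le {V : Type*} [Fintype V] [Nonempty V] {G : SimpleGraph V}
    (hvt : ∀ u v : V, ∃ e : G ≃g G, e u = v)
    {B : Matrix V V ℝ} (hB : B.PosSemidef) (hB1 : ∀ i, B i i = 1)
    (hB0 : ∀ i j, G.Adj i j → B i j = 0) {x : V → ℝ} (hx : ∑ i, x i ^ 2 = 1)
    {C : Matrix V V ℝ} (hC : C.PosSemidef) (hC1 : ∀ i, C i i = 1)
    (hC0 : ∀ i j, Gᶜ.Adj i j → C i j = 0) {y : V → ℝ} (hy : ∑ i, y i ^ 2 = 1) :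
    qf B x * qf C y ≤ Fintype.card V := by
  classical
  obtain ⟨D, hD, hD1, hD0, hDr⟩ := average hvt (scale_psd hB x)
    (by simpa [hB1, ← pow_two] using hx)
    (fun i j hij => by simp [hB0 i j hij])
  set n : ℝ := (Fintype.card V : ℝ) with hn
  have hn0 : 0 < n := by rw [hn]; exact_mod_cast Fintype.card_pos
  set l := qf B x with hl
  have hDr' : ∀ i, ∑ j, D i j = l := hDr
  obtain ⟨hs, hq⟩ := (psd_iff D).1 hD
  have hDc : ∀ j, ∑ i, D i j = l := fun j => by
    rw [← hDr' j]; exact Finset.sum_congr rfl fun i _ => hs i j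
  have hM : (Matrix.of fun i j => D i j - l / n : Matrix V V ℝ).PosSemidef := by
    rw [psd_iff]
    refine ⟨fun i j => by simp [hs i j], fun z => ?_⟩
    have key := hq (fun i => z i - (∑ k, z k) / n)
    set m := (∑ k, z k) / n with hmdef
    have hz : ∑ k, z k = n * m := by rw [hmdef]; field_simp
    have e1 : qf D (fun i => z i - m) = qf D z - l * n * m ^ 2 := by
      have a1 : ∑ i, ∑ j, z i * D i j = l * (n * m) := by
        simp only [← Finset.mul_sum, hDr', ← Finset.sum_mul, hz]; ring
      have a2 : ∑ i, ∑ j, z j * D i j = l * (n * m) := by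
        rw [Finset.sum_comm]
        simp only [← Finset.mul_sum, hDc, ← Finset.sum_mul, hz]; ring
      have a3 : ∑ i, ∑ j, D i j = n * l := by
        simp [hDr', hn]
      have : qf D (fun i => z i - m) = qf D z - m * (∑ i, ∑ j, z i * D i j)
          - m * (∑ i, ∑ j, z j * D i j) + m ^ 2 * ∑ i, ∑ j, D i j := by
        simp only [qf, Finset.mul_sum, ← Finset.sum_sub_distrib, ← Finset.sum_add_distrib]
        refine Finset.sum_congr rfl fun i _ => Finset.sum_congr rfl fun j _ => by ring
      rw [this, a1, a2, a3]; ring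
    have e2 : qf (Matrix.of fun i j => D i j - l / n : Matrix V V ℝ) z =
        qf D z - l / n * ((∑ i, z i) * ∑ j, z j) := by
      rw [Finset.sum_mul_sum]
      simp only [qf, Finset.mul_sum, ← Finset.sum_sub_distrib, of_apply]
      refine Finset.sum_congr rfl fun i _ => Finset.sum_congr rfl fun j _ => by ring
    rw [e2, hz]
    rw [e1] at key
    have : l / n * (n * m * (n * m)) = l * n * m ^ 2 := by field_simp
    rw [this]; exact key
  have h := ((psd_iff _).1 ((hM.hadamard (scale_psd hC y)))).2 (fun _ => 1)
  have e3 : ∑ i, ∑ j, D i j * (y i * y j * C i j) = 1 := by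
    rw [← hy]
    refine Finset.sum_congr rfl fun i _ => ?_
    rw [Finset.sum_eq_single i]
    · rw [hD1, hC1]; ring
    · intro j _ hj
      by_cases hij : G.Adj i j
      · rw [hD0 i j hij]; ring
      · rw [hC0 i j (by rw [SimpleGraph.compl_adj]; exact ⟨hj.symm, hij⟩)]; ring
    · simp
  have e4 : qf ((Matrix.of fun i j => D i j - l / n : Matrix V V ℝ) ⊙
      (Matrix.of fun i j => y i * y j * C i j)) (fun _ => 1) =
      ∑ i, ∑ j, D i j * (y i * y j * C i j) - l / n * qf C y := by
    simp only [qf, Finset.mul_sum, ← Finset.sum_sub_distrib, hadamard_apply, of_apply]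
    refine Finset.sum_congr rfl fun i _ => Finset.sum_congr rfl fun j _ => by ring
  rw [e4, e3] at h
  have : l / n * qf C y * n ≤ 1 * n := by gcongr; linarith
  calc l * qf C y = l / n * qf C y * n := by field_simp
    _ ≤ n := by linarith

/-- SDP duality -/
lemma dual {V : Type*} [Fintype V] [Nonempty V] {G : SimpleGraph V}
    {t : ℝ} (ht1 : 1 < t)
    (ht : ∀ B : Matrix V V ℝ, B.PosSemidef → ∑ i, B i i = 1 → (∀ i j, G.Adj i j → B i j = 0) →
      ∑ i, ∑ j, B i j < t) :
    ∃ Z : Matrix V V ℝ, (∀ i j, Z i j = Z j i) ∧ (∀ i, Z i i = t) ∧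
      (∀ i j, Gᶜ.Adj i j → Z i j = 0) ∧ ∀ x, (∑ i, x i) ^ 2 ≤ qf Z x := by
  classical
  let K : Set (V → V → ℝ) := {B | (Matrix.of B).PosSemidef ∧ ∑ i, B i i = 1}
  have hKconv : Convex ℝ K := by
    rintro A ⟨hA, hA1⟩ B ⟨hB, hB1⟩ a b ha hb hab
    refine ⟨(hA.smul ha).add (hB.smul hb), ?_⟩
    simp only [Pi.add_apply, Pi.smul_apply, smul_eq_mul, Finset.sum_add_distrib, ← Finset.mul_sum,
      hA1, hB1]
    linarith
  have hKcomp : IsCompact K := by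
    have hc : IsClosed K := by
      have : K = {B : V → V → ℝ | ∀ i j, B i j = B j i} ∩
          {B : V → V → ℝ | ∀ x : V → ℝ, 0 ≤ ∑ i, ∑ j, x i * x j * B i j} ∩
          {B : V → V → ℝ | ∑ i, B i i = 1} := by
        ext B
        simp only [K, Set.mem_setOf_eq, Set.mem_inter_iff, psd_iff]
        rfl
      rw [this]
      refine (IsClosed.inter ?_ ?_).inter ?_
      · simp only [Set.setOf_forall]
        exact isClosed_iInter fun i => isClosed_iInter fun j =>
          isClosed_eq (by fun_prop) (by fun_prop)
      · simp only [Set.setOf_forall]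
        exact isClosed_iInter fun x => isClosed_le (by fun_prop) (by fun_prop)
      · exact isClosed_eq (by fun_prop) (by fun_prop)
    have hbox : IsCompact (Set.univ.pi fun _ : V => Set.univ.pi fun _ : V => Set.Icc (-1 : ℝ) 1) :=
      isCompact_univ_pi fun _ => isCompact_univ_pi fun _ => isCompact_Icc
    refine hbox.of_isClosed_subset hc ?_
    rintro B ⟨hB, hB1⟩ i _ j _
    have hd : ∀ i, B i i ≤ 1 := fun i => by
      rw [← hB1]
      exact Finset.single_le_sum (f := fun i => B i i) (fun i _ => hB.diag_nonneg (i := i))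
        (Finset.mem_univ i)
    have h := entry_le hB i j
    simp only [of_apply] at h
    have := hd i
    have := hd j
    exact abs_le.1 (by linarith)
  let φ : (V → V → ℝ) →ₗ[ℝ] (V → V → ℝ) × ℝ :=
    { toFun := fun B => (fun i j => if G.Adj i j then B i j else 0, ∑ i, ∑ j, B i j)
      map_add' := by
        intro A B
        refine Prod.ext ?_ ?_
        · ext i j
          by_cases h : G.Adj i j <;> simp [h]
        · simp [Finset.sum_add_distrib]
      map_smul' := by
        intro a B
        refine Prod.ext ?_ ?_
        · ext i j
          by_cases h : G.Adj i j <;> simp [h]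
        · simp [Finset.mul_sum] }
  have hφc : Continuous φ := LinearMap.continuous_of_finiteDimensional φ
  let T : Set ((V → V → ℝ) × ℝ) := {0} ×ˢ Set.Ici t
  obtain ⟨f, u, v, hfK, huv, hfT⟩ := geometric_hahn_banach_compact_closed
    (s := φ '' K) (t := T) (hKconv.linear_image φ) (hKcomp.image hφc)
    ((convex_singleton 0).prod (convex_Ici t)) (isClosed_singleton.prod isClosed_Ici) (by
      rw [Set.disjoint_left]
      rintro _ ⟨B, ⟨hB, hB1⟩, rfl⟩ ⟨h1, h2⟩
      have h1' : (φ B).1 = 0 := h1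
      have h2' : t ≤ ∑ i, ∑ j, B i j := h2
      refine absurd (ht (Matrix.of B) hB hB1 ?_) (not_lt.2 h2')
      intro i j hij
      have := congrFun (congrFun h1' i) j
      simpa [φ, hij] using this)
  set β := f (0, 1) with hβ
  have hf0 : ∀ s : ℝ, f (0, s) = s * β := by
    intro s
    rw [hβ, ← smul_eq_mul, ← map_smul]
    simp
  have hTs : ∀ s, t ≤ s → v < s * β := fun s hs => by
    rw [← hf0]; exact hfT _ ⟨rfl, hs⟩
  have hI : β < u := by
    have hn0 : (0 : ℝ) < Fintype.card V := by exact_mod_cast Fintype.card_pos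
    have := hfK (φ (fun i j => (Fintype.card V : ℝ)⁻¹ * (1 : Matrix V V ℝ) i j)) ⟨_, ⟨?_, ?_⟩, rfl⟩
    · have e : φ (fun i j => (Fintype.card V : ℝ)⁻¹ * (1 : Matrix V V ℝ) i j) = (0, 1) := by
        refine Prod.ext ?_ ?_
        · ext i j
          by_cases h : G.Adj i j
          · simp [φ, h, Matrix.one_apply, h.ne]
          · simp [φ, h]
        · simp [φ, Matrix.one_apply]
      rwa [e] at this
    · exact (PosSemidef.one (n := V) (R := ℝ)).smul (a := (Fintype.card V : ℝ)⁻¹) (by positivity)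
    · simp
  have hβ0 : 0 < β := by
    have := hTs t le_rfl
    by_contra hneg
    push Not at hneg
    nlinarith
  -- coefficients
  let A : V → V → ℝ := fun i j => f (Pi.single i (Pi.single j 1), 0)
  have hA : ∀ M : V → V → ℝ, f (M, 0) = ∑ i, ∑ j, M i j * A i j := by
    intro M
    have hM : ((M, 0) : (V → V → ℝ) × ℝ) =
        ∑ i, ∑ j, M i j • ((Pi.single i (Pi.single j 1), 0) : (V → V → ℝ) × ℝ) := by
      refine Prod.ext ?_ ?_
      · simp only [Prod.fst_sum, Prod.smul_fst]
        ext k l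
        simp [Finset.sum_apply, Pi.single_apply, Finset.sum_ite_eq, ite_apply]
      · simp [Prod.snd_sum]
    rw [hM]
    simp only [map_sum, map_smul, smul_eq_mul, A]
  have hmain : ∀ x : V → ℝ, ∑ i, x i ^ 2 = 1 →
      (∑ i, ∑ j, (if G.Adj i j then x i * x j else 0) * A i j) + β * (∑ i, x i) ^ 2 ≤ t * β := by
    intro x hx
    have h1 := hfK _ ⟨fun i j => x i * x j, ⟨vv_psd x, by simpa [← pow_two] using hx⟩, rfl⟩
    have e : φ (fun i j => x i * x j) =
        (fun i j => if G.Adj i j then x i * x j else 0, 0) + (0, (∑ i, x i) ^ 2) := by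
      refine Prod.ext ?_ ?_
      · simp [φ]
      · simp [φ, pow_two, Finset.sum_mul_sum]
    rw [e, map_add, hA, hf0] at h1
    have := hTs t le_rfl
    linarith
  let Z : Matrix V V ℝ := fun i j =>
    (if i = j then t else 0) - (if G.Adj i j then (A i j + A j i) / (2 * β) else 0)
  have hZq : ∀ x : V → ℝ, β * qf Z x = t * β * ∑ i, x i ^ 2 -
      ∑ i, ∑ j, (if G.Adj i j then x i * x j else 0) * A i j := by
    intro x
    have e1 : ∑ i, ∑ j, (if G.Adj i j then x i * x j else 0) * A i j =
        ∑ i, ∑ j, (if G.Adj i j then x i * x j else 0) * A j i := by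
      rw [Finset.sum_comm]
      refine Finset.sum_congr rfl fun i _ => Finset.sum_congr rfl fun j _ => ?_
      simp only [G.adj_comm j i, mul_comm (x j)]
    have e2 : t * β * ∑ i, x i ^ 2 = ∑ i, ∑ j, (if i = j then t * β * (x i * x j) else 0) := by
      simp [Finset.mul_sum, pow_two]
    have e3 : ∑ i, ∑ j, (if G.Adj i j then x i * x j else 0) * A i j =
        ∑ i, ∑ j, (if G.Adj i j then x i * x j else 0) * ((A i j + A j i) / 2) := by
      have : ∑ i, ∑ j, (if G.Adj i j then x i * x j else 0) * ((A i j + A j i) / 2) =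
        (∑ i, ∑ j, (if G.Adj i j then x i * x j else 0) * A i j +
        ∑ i, ∑ j, (if G.Adj i j then x i * x j else 0) * A j i) / 2 := by
        simp only [← Finset.sum_add_distrib, Finset.sum_div]
        refine Finset.sum_congr rfl fun i _ => Finset.sum_congr rfl fun j _ => by ring
      rw [this, ← e1]; ring
    rw [e2, e3]
    simp only [qf, Finset.mul_sum, ← Finset.sum_sub_distrib]
    refine Finset.sum_congr rfl fun i _ => Finset.sum_congr rfl fun j _ => ?_
    simp only [Z]
    split_ifs <;> field_simp <;> ring
  refine ⟨Z, ?_, ?_, ?_, ?_⟩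
  · intro i j
    simp only [Z, G.adj_comm j i, eq_comm (a := j), add_comm (A j i)]
  · intro i
    simp [Z]
  · intro i j hij
    rw [SimpleGraph.compl_adj] at hij
    simp [Z, hij.1, hij.2]
  · intro x
    by_cases hx : ∑ i, x i ^ 2 = 0
    · have : ∀ i, x i = 0 := by
        intro i
        have := (Finset.sum_eq_zero_iff_of_nonneg (fun i _ => sq_nonneg (x i))).1 hx i
          (Finset.mem_univ i)
        simpa using this
      simp [qf, this]
    · have hpos : 0 < ∑ i, x i ^ 2 := lt_of_le_of_ne (by positivity) (Ne.symm hx)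
      set r := Real.sqrt (∑ i, x i ^ 2) with hr
      have hr0 : 0 < r := Real.sqrt_pos.2 hpos
      have hr2 : r ^ 2 = ∑ i, x i ^ 2 := Real.sq_sqrt hpos.le
      have hy : ∑ i, (x i / r) ^ 2 = 1 := by
        simp only [div_pow, ← Finset.sum_div]
        rw [← hr2]; field_simp
      have h1 := hmain (fun i => x i / r) hy
      have h2 := hZq (fun i => x i / r)
      rw [hy] at h2
      have h3 : β * (∑ i, x i / r) ^ 2 ≤ β * qf Z (fun i => x i / r) := by linarith
      have h4 := le_of_mul_le_mul_left h3 hβ0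
      have h5 : qf Z (fun i => x i / r) = qf Z x / r ^ 2 := by
        simp only [qf, Finset.sum_div]
        refine Finset.sum_congr rfl fun i _ => Finset.sum_congr rfl fun j _ => by field_simp
      rw [h5, ← Finset.sum_div, div_pow] at h4
      exact (div_le_div_iff_of_pos_right (by positivity)).1 h4

lemma const_unit (V : Type*) [Fintype V] [Nonempty V] :
    ∑ _i : V, ((Real.sqrt (Fintype.card V))⁻¹) ^ 2 = 1 := by
  have hn0 : (0 : ℝ) < Fintype.card V := by exact_mod_cast Fintype.card_pos
  rw [inv_pow, Real.sq_sqrt hn0.le]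
  simp

lemma qf_const {V : Type*} [Fintype V] (B : Matrix V V ℝ) :
    qf B (fun _ => (Real.sqrt (Fintype.card V))⁻¹) =
      (Fintype.card V : ℝ)⁻¹ * ∑ i, ∑ j, B i j := by
  simp only [qf, Finset.mul_sum]
  refine Finset.sum_congr rfl fun i _ => Finset.sum_congr rfl fun j _ => ?_
  rw [← mul_inv, Real.mul_self_sqrt (by positivity)]

lemma one_le_theta {V : Type*} [Fintype V] [Nonempty V] (G : SimpleGraph V) :
    1 ≤ lovaszTheta G := by
  classical
  have := le_theta (G := G) (PosSemidef.one (n := V) (R := ℝ)) (by simp)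
    (fun i j h => by simp [Matrix.one_apply, h.ne]) (const_unit V)
  rw [qf_const] at this
  simpa [Matrix.one_apply] using this

lemma main_theorem {V : Type*} [Fintype V] [Nonempty V] (G : SimpleGraph V)
    (hvt : ∀ u v : V, ∃ e : G ≃g G, e u = v) :
    lovaszTheta G * lovaszTheta Gᶜ = Fintype.card V := by
  have hn0 : (0 : ℝ) < Fintype.card V := by exact_mod_cast Fintype.card_pos
  have g1 := one_le_theta G
  have g2 := one_le_theta Gᶜ
  apply le_antisymm
  · rw [← le_div_iff₀ (by linarith)]
    refine theta_le (by positivity) ?_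
    intro B hB hB1 hB0 x hx
    rw [le_div_iff₀ (by linarith)]
    rcases ((psd_iff B).1 hB).2 x |>.eq_or_lt with hb | hb
    · rw [← hb]; simp
    · rw [mul_comm, ← le_div_iff₀ hb]
      refine theta_le (by positivity) ?_
      intro C hC hC1 hC0 y hy
      rw [le_div_iff₀ hb, mul_comm]
      exact prod_le hvt hB hB1 hB0 hx hC hC1 hC0 hy
  · rw [← div_le_iff₀ (by linarith)]
    refine le_of_forall_gt_imp_ge_of_dense fun t ht => ?_
    have ht0 : 0 < t := by linarith
    rw [div_le_iff₀ (by linarith)]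
    obtain ⟨Z, hZs, hZd, hZ0, hZq⟩ := dual (G := G) (t := t) (by linarith) (by
      intro B hB htr h0
      obtain ⟨D, hD, hD1, hD0, hDr⟩ := average hvt hB htr h0
      have := le_theta hD hD1 hD0 (const_unit V)
      rw [qf_const] at this
      simp only [hDr, Finset.sum_const, Finset.card_univ, nsmul_eq_mul] at this
      rw [inv_mul_cancel_left₀ hn0.ne'] at this
      linarith)
    have hp : (t⁻¹ • Z).PosSemidef := by
      refine PosSemidef.smul ?_ (by positivity)
      rw [psd_iff]
      exact ⟨hZs, fun x => (sq_nonneg _).trans (hZq x)⟩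
    have h := le_theta (G := Gᶜ) hp (fun i => by simp [hZd, ht0.ne'])
      (fun i j hij => by simp [hZ0 i j hij]) (const_unit V)
    rw [qf_const] at h
    have h1 := hZq (fun _ => 1)
    simp only [Finset.sum_const, Finset.card_univ, nsmul_eq_mul, mul_one, qf, one_mul] at h1
    simp only [Matrix.smul_apply, smul_eq_mul, ← Finset.mul_sum] at h
    rw [← div_le_iff₀' ht0]
    refine le_trans ?_ h
    calc (Fintype.card V : ℝ) / t = (Fintype.card V : ℝ)⁻¹ * (t⁻¹ * (Fintype.card V : ℝ) ^ 2) := by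
          field_simp
      _ ≤ _ := by gcongr

/-- For a vertex-transitive graph `G` on `N` nodes, `ϑ(G) ⬝ ϑ(Ḡ) = N`. -/
theorem lovasz_theta_vertex_transitive_product (N : ℕ) (G : SimpleGraph (Fin N))
    (hvt : ∀ u v : Fin N, ∃ e : G ≃g G, e u = v) :
    lovaszTheta G * lovaszTheta Gᶜ = N := by
  rcases Nat.eq_zero_or_pos N with rfl | hN
  · have h : lovaszTheta G = 0 := by
      apply le_antisymm
      · refine theta_le le_rfl ?_
        intro B _ _ _ x _
        simp [qf]
      · refine Real.sSup_nonneg ?_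
        rintro t ⟨B, _, _, _, _, rfl⟩
        refine Real.sSup_nonneg ?_
        rintro r ⟨x, hx, rfl⟩
        simp at hx
    simp [h]
  · haveI : Nonempty (Fin N) := ⟨⟨0, hN⟩⟩
    simpa using main_theorem G hvt
end

section
/- For the adjusted random Hamiltonian including all up-to-p-local Paulis, every product state maximizes the variance: for any product state |\phi\rangle and any state |\psi\rangle on n qubits, E[(\langle\psi|H_{n,(1..p)}|\psi\rangle)^2] \leq E[(\langle\phi|H_{n,(1..p)}|\phi\rangle)^2] = 1. -/
open Matrix MeasureTheory ProbabilityTheory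

noncomputable def PauliX : Matrix (Fin 2) (Fin 2) ℂ := !![0, 1; 1, 0]
noncomputable def PauliY : Matrix (Fin 2) (Fin 2) ℂ := !![0, -Complex.I; Complex.I, 0]
noncomputable def PauliZ : Matrix (Fin 2) (Fin 2) ℂ := !![1, 0; 0, -1]

noncomputable def pauli1 : Fin 4 → Matrix (Fin 2) (Fin 2) ℂ := ![1, PauliX, PauliY, PauliZ]

noncomputable def pauliString (n : ℕ) (a : Fin n → Fin 4) :
    Matrix (Fin n → Fin 2) (Fin n → Fin 2) ℂ :=
  fun i j => ∏ k, pauli1 (a k) (i k) (j k)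

/-- Index set for the adjusted model: an increasing `p`-tuple of qubits together with an
arbitrary Pauli label in `{I, X, Y, Z}` on each of them. -/
abbrev SpinIdx4 (n p : ℕ) :=
  {f : Fin p → Fin n // ∀ i j : Fin p, i < j → f i < f j} × (Fin p → Fin 4)

noncomputable def embedString4 (n p : ℕ) (f : Fin p → Fin n) (a : Fin p → Fin 4) :
    Fin n → Fin 4 :=
  fun i => if h : ∃ j, f j = i then a (Classical.choose h) else 0

/-- The adjusted random Hamiltonian `H_{n,(1..p)}` including all up-to-`p`-local Paulis,
normalized by `2^{-p/2} C(n,p)^{-1/2}`. -/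
noncomputable def Hadj (n p : ℕ) (α : SpinIdx4 n p → ℝ) :
    Matrix (Fin n → Fin 2) (Fin n → Fin 2) ℂ :=
  ((Real.sqrt (2 ^ p * n.choose p) : ℂ))⁻¹ •
    ∑ idx : SpinIdx4 n p, (α idx : ℂ) • pauliString n (embedString4 n p idx.1.1 idx.2)

noncomputable def prodState (n : ℕ) (φ : Fin n → Fin 2 → ℂ) : (Fin n → Fin 2) → ℂ :=
  fun i => ∏ k, φ k (i k)

noncomputable def energyAdj (n p : ℕ) (α : SpinIdx4 n p → ℝ)
    (Φ : (Fin n → Fin 2) → ℂ) : ℝ :=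
  Complex.re (∑ i, (starRingEnd ℂ) (Φ i) * ((Hadj n p α).mulVec Φ) i)

/-- The expectation `⟨Φ|P|Φ⟩`. -/
noncomputable def expc {ι : Type*} [Fintype ι] (P : Matrix ι ι ℂ) (Φ : ι → ℂ) : ℂ :=
  ∑ i, ∑ j, (starRingEnd ℂ) (Φ i) * P i j * Φ j

lemma gauss_second_moment {ι : Type*} [Fintype ι] (c : ι → ℝ) :
    ∫ α : ι → ℝ, (∑ i, α i * c i) ^ 2 ∂(Measure.pi fun _ : ι => gaussianReal 0 1)
      = ∑ i, c i ^ 2 := by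
  have hmem : ∀ i, MemLp (fun x : ℝ => x * c i) 2 (gaussianReal 0 1) := fun i =>
    (memLp_id_gaussianReal' 2 (by simp)).mul_const (c i)
  have h := variance_sum_pi (μ := fun _ : ι => gaussianReal 0 1)
    (X := fun i (x : ℝ) => x * c i) hmem
  have e : (∑ i, fun ω : ι → ℝ => ω i * c i) = fun ω => ∑ i, ω i * c i := by
    ext ω; simp
  rw [e, variance_of_integral_eq_zero] at h
  · rw [h]
    refine Finset.sum_congr rfl fun i _ => ?_
    have := variance_mul_const (c i) id (gaussianReal 0 1)
    rw [variance_id_gaussianReal] at this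
    exact this.trans (by simp)
  · exact Measurable.aemeasurable (by fun_prop)
  · rw [integral_finsetSum]
    · refine Finset.sum_eq_zero fun i _ => ?_
      have := integral_comp_eval (μ := fun _ : ι => gaussianReal 0 1) (i := i)
        (f := fun x : ℝ => x * c i) (hmem i).aestronglyMeasurable
      rw [this, integral_mul_const, integral_id_gaussianReal, zero_mul]
    · intro i _
      exact integrable_comp_eval (μ := fun _ : ι => gaussianReal 0 1) (i := i)
        (f := fun x : ℝ => x * c i) ((hmem i).integrable (by norm_num))

lemma energy_eq (n p : ℕ) (α : SpinIdx4 n p → ℝ) (Φ : (Fin n → Fin 2) → ℂ) :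
    energyAdj n p α Φ = ∑ idx, α idx * ((Real.sqrt (2 ^ p * n.choose p))⁻¹ *
      (expc (pauliString n (embedString4 n p idx.1.1 idx.2)) Φ).re) := by
  have : (∑ i, (starRingEnd ℂ) (Φ i) * ((Hadj n p α).mulVec Φ) i) =
      ∑ idx, (((α idx * (Real.sqrt (2 ^ p * n.choose p))⁻¹ : ℝ)) : ℂ) *
        expc (pauliString n (embedString4 n p idx.1.1 idx.2)) Φ := by
    have e : ∀ i j, Hadj n p α i j = ∑ idx, ((Real.sqrt (2 ^ p * n.choose p) : ℂ))⁻¹ *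
        ((α idx : ℂ) * pauliString n (embedString4 n p idx.1.1 idx.2) i j) := by
      intro i j
      simp only [Hadj, Matrix.smul_apply, Matrix.sum_apply, smul_eq_mul, Finset.mul_sum]
    simp only [Matrix.mulVec, dotProduct, e, expc, Finset.mul_sum, Finset.sum_mul]
    refine Eq.trans (Finset.sum_congr rfl fun i _ => ?_) Finset.sum_comm
    refine Eq.trans (Finset.sum_congr rfl fun j _ => ?_) Finset.sum_comm
    refine Finset.sum_congr rfl fun idx _ => ?_
    push_cast
    ring
  rw [energyAdj, this, Complex.re_sum]
  refine Finset.sum_congr rfl fun _ _ => ?_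
  rw [Complex.re_ofReal_mul]
  ring

lemma card_mono (n p : ℕ) :
    Fintype.card {f : Fin p → Fin n // ∀ i j : Fin p, i < j → f i < f j} = n.choose p := by
  classical
  have : Fintype.card {f : Fin p → Fin n // ∀ i j : Fin p, i < j → f i < f j} =
      (Finset.powersetCard p (Finset.univ : Finset (Fin n))).card := by
    rw [← Finset.card_univ]
    refine Finset.card_bij (fun f _ => Finset.univ.image f.1) ?_ ?_ ?_
    · intro f _
      have hf : StrictMono f.1 := fun i j h => f.2 i j h
      simp [Finset.mem_powersetCard, Finset.card_image_of_injective _ hf.injective]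
    · intro f _ g _ h
      have hf : StrictMono f.1 := fun i j h => f.2 i j h
      have hg : StrictMono g.1 := fun i j h => g.2 i j h
      apply Subtype.ext
      rw [← hf.range_inj hg, ← Set.image_univ, ← Set.image_univ, ← Finset.coe_univ,
        ← Finset.coe_image, ← Finset.coe_image, h]
    · intro s hs
      rw [Finset.mem_powersetCard] at hs
      refine ⟨⟨s.orderEmbOfFin hs.2, fun i j h => (s.orderEmbOfFin hs.2).strictMono h⟩,
        Finset.mem_univ _, ?_⟩
      apply Finset.coe_injective
      simp
  rw [this]; simp

lemma sum_prod_embed {R : Type*} [CommSemiring R] (n p : ℕ) (f : Fin p → Fin n)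
    (hf : Function.Injective f) (F : Fin n → Fin 4 → R) :
    ∑ a : Fin p → Fin 4, ∏ k, F k (embedString4 n p f a k) =
      ∏ k, if k ∈ Finset.univ.image f then ∑ b, F k b else F k 0 := by
  have h1 : ∀ a : Fin p → Fin 4, ∏ k, F k (embedString4 n p f a k) =
      (∏ j, F (f j) (a j)) * ∏ k ∈ (Finset.univ.image f)ᶜ, F k 0 := by
    intro a
    rw [← Finset.prod_mul_prod_compl (Finset.univ.image f), Finset.prod_image hf.injOn]
    congr 1
    · refine Finset.prod_congr rfl fun j _ => ?_
      have h : ∃ j', f j' = f j := ⟨j, rfl⟩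
      rw [embedString4, dif_pos h, hf (Classical.choose_spec h)]
    · refine Finset.prod_congr rfl fun k hk => ?_
      have h : ¬ ∃ j', f j' = k := by simpa using hk
      rw [embedString4, dif_neg h]
  simp only [h1]
  rw [← Finset.sum_mul, ← Finset.prod_mul_prod_compl (Finset.univ.image f),
    Finset.prod_image hf.injOn]
  congr 1
  · rw [← Fintype.prod_sum]
    refine Finset.prod_congr rfl fun j _ => ?_
    rw [if_pos (by simp)]
  · refine Finset.prod_congr rfl fun k hk => ?_
    rw [if_neg (by simpa using hk)]

lemma pauli_complete (i j k l : Fin 2) :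
    ∑ b, pauli1 b i j * (starRingEnd ℂ) (pauli1 b k l) = if i = k ∧ j = l then 2 else 0 := by
  fin_cases i <;> fin_cases j <;> fin_cases k <;> fin_cases l <;>
    simp [Fin.sum_univ_four, pauli1, PauliX, PauliY, PauliZ] <;> norm_num

lemma kernel_eq (n p : ℕ) (f : Fin p → Fin n) (hf : Function.Injective f)
    (i j k l : Fin n → Fin 2) :
    ∑ a, pauliString n (embedString4 n p f a) i j *
        (starRingEnd ℂ) (pauliString n (embedString4 n p f a) k l) =
      if j = (Finset.univ.image f).piecewise l i ∧ k = (Finset.univ.image f).piecewise i l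
      then 2 ^ p else 0 := by
  simp only [pauliString, map_prod, ← Finset.prod_mul_distrib]
  rw [sum_prod_embed n p f hf (fun m b => pauli1 b (i m) (j m) *
    (starRingEnd ℂ) (pauli1 b (k m) (l m)))]
  simp only [pauli_complete]
  have hc : (Finset.univ.image f).card = p := by
    simp [Finset.card_image_of_injective _ hf]
  split_ifs with h
  · obtain ⟨rfl, rfl⟩ := h
    have : ∀ m, (if m ∈ Finset.univ.image f then
        if i m = (Finset.univ.image f).piecewise i l m ∧
          (Finset.univ.image f).piecewise l i m = l m then (2 : ℂ) else 0
        else pauli1 0 (i m) ((Finset.univ.image f).piecewise l i m) *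
          (starRingEnd ℂ) (pauli1 0 ((Finset.univ.image f).piecewise i l m) (l m))) =
        if m ∈ Finset.univ.image f then 2 else 1 := by
      intro m
      by_cases hm : m ∈ Finset.univ.image f
      · simp only [if_pos hm, Finset.piecewise_eq_of_mem _ _ _ hm, and_self, if_true]
      · simp only [if_neg hm, Finset.piecewise_eq_of_notMem _ _ _ hm]
        simp [pauli1]
    simp only [this]
    rw [Finset.prod_ite_mem, Finset.univ_inter, Finset.prod_const, hc]
  · have : ∃ m, ¬ (j m = (Finset.univ.image f).piecewise l i m ∧
        k m = (Finset.univ.image f).piecewise i l m) := by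
      by_contra hcon
      push Not at hcon
      exact h ⟨funext fun m => (hcon m).1, funext fun m => (hcon m).2⟩
    obtain ⟨m, hm⟩ := this
    apply Finset.prod_eq_zero (Finset.mem_univ m)
    by_cases hS : m ∈ Finset.univ.image f
    · simp only [Finset.piecewise_eq_of_mem _ _ _ hS] at hm
      rw [if_pos hS, if_neg]
      rintro ⟨h1, h2⟩
      exact hm ⟨h2, h1.symm⟩
    · simp only [Finset.piecewise_eq_of_notMem _ _ _ hS] at hm
      rw [if_neg hS]
      by_cases h1 : i m = j m
      · have h2 : k m ≠ l m := fun h2 => hm ⟨h1.symm, h2⟩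
        simp [pauli1, Matrix.one_apply_ne h2]
      · simp [pauli1, Matrix.one_apply_ne h1]

lemma sum_normSq_eq (n p : ℕ) (f : Fin p → Fin n) (hf : Function.Injective f)
    (ψ : (Fin n → Fin 2) → ℂ) :
    ((∑ a, Complex.normSq (expc (pauliString n (embedString4 n p f a)) ψ) : ℝ) : ℂ) =
      ∑ i, ∑ l, 2 ^ p * ((starRingEnd ℂ) (ψ i) * (starRingEnd ℂ) (ψ l) *
        (ψ ((Finset.univ.image f).piecewise l i) * ψ ((Finset.univ.image f).piecewise i l))) := by
  have h1 : ∀ P : Matrix (Fin n → Fin 2) (Fin n → Fin 2) ℂ,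
      ((Complex.normSq (expc P ψ) : ℝ) : ℂ) = ∑ i, ∑ l, ∑ j, ∑ k,
        ((starRingEnd ℂ) (ψ i) * (starRingEnd ℂ) (ψ l) * (ψ j * ψ k)) *
          (P i j * (starRingEnd ℂ) (P k l)) := by
    intro P
    rw [← Complex.mul_conj]
    simp only [expc, map_sum, map_mul, Complex.conj_conj]
    rw [Finset.sum_mul]
    refine Finset.sum_congr rfl fun i _ => ?_
    rw [Finset.sum_comm, Finset.sum_mul_sum, Finset.sum_comm]
    refine Finset.sum_congr rfl fun l _ => ?_
    refine Finset.sum_congr rfl fun j _ => ?_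
    rw [Finset.mul_sum]
    refine Finset.sum_congr rfl fun k _ => ?_
    ring
  rw [Complex.ofReal_sum]
  simp only [h1]
  rw [Finset.sum_comm]
  refine Finset.sum_congr rfl fun i _ => ?_
  rw [Finset.sum_comm]
  refine Finset.sum_congr rfl fun l _ => ?_
  rw [Finset.sum_comm]
  have h2 : ∀ j k, ∑ a, ((starRingEnd ℂ) (ψ i) * (starRingEnd ℂ) (ψ l) * (ψ j * ψ k)) *
      (pauliString n (embedString4 n p f a) i j *
        (starRingEnd ℂ) (pauliString n (embedString4 n p f a) k l)) =
      if j = (Finset.univ.image f).piecewise l i then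
        if k = (Finset.univ.image f).piecewise i l then
          2 ^ p * ((starRingEnd ℂ) (ψ i) * (starRingEnd ℂ) (ψ l) * (ψ j * ψ k)) else 0 else 0 := by
    intro j k
    rw [← Finset.mul_sum, kernel_eq n p f hf, ite_and]
    split_ifs <;> ring
  have h3 : ∀ j, ∑ a, ∑ k, ((starRingEnd ℂ) (ψ i) * (starRingEnd ℂ) (ψ l) * (ψ j * ψ k)) *
      (pauliString n (embedString4 n p f a) i j *
        (starRingEnd ℂ) (pauliString n (embedString4 n p f a) k l)) =
      if j = (Finset.univ.image f).piecewise l i then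
          2 ^ p * ((starRingEnd ℂ) (ψ i) * (starRingEnd ℂ) (ψ l) *
            (ψ j * ψ ((Finset.univ.image f).piecewise i l))) else 0 := by
    intro j
    rw [Finset.sum_comm]
    simp only [h2]
    split_ifs
    · rw [Finset.sum_ite_eq' Finset.univ]; simp
    · simp
  simp only [h3]
  rw [Finset.sum_ite_eq' Finset.univ]; simp

lemma sum_normSq_le (n p : ℕ) (f : Fin p → Fin n) (hf : Function.Injective f)
    (ψ : (Fin n → Fin 2) → ℂ) (hψ : ∑ i, Complex.normSq (ψ i) = 1) :
    ∑ a, Complex.normSq (expc (pauliString n (embedString4 n p f a)) ψ) ≤ 2 ^ p := by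
  set S := Finset.univ.image f with hS
  have h := sum_normSq_eq n p f hf ψ
  have hre := congrArg Complex.re h
  rw [Complex.ofReal_re] at hre
  rw [hre]
  refine (Complex.re_le_norm _).trans ?_
  have hN : ∑ i, ‖ψ i‖ ^ 2 = 1 := by
    simpa [Complex.normSq_eq_norm_sq] using hψ
  have hA : ∑ q : (Fin n → Fin 2) × (Fin n → Fin 2), ‖ψ q.1‖ ^ 2 * ‖ψ q.2‖ ^ 2 = 1 := by
    rw [Fintype.sum_prod_type]
    simp only [← Finset.mul_sum, hN, mul_one]
  let T : (Fin n → Fin 2) × (Fin n → Fin 2) → (Fin n → Fin 2) × (Fin n → Fin 2) :=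
    fun q => (S.piecewise q.2 q.1, S.piecewise q.1 q.2)
  have hT : Function.Involutive T := by
    intro q
    refine Prod.ext (funext fun m => ?_) (funext fun m => ?_) <;>
    · by_cases hm : m ∈ S <;> simp [T, hm]
  have hB : ∑ q, ‖ψ (T q).1‖ ^ 2 * ‖ψ (T q).2‖ ^ 2 = 1 := by
    rw [← hA]
    exact Equiv.sum_comp hT.toPerm (fun q => ‖ψ q.1‖ ^ 2 * ‖ψ q.2‖ ^ 2)
  rw [← Fintype.sum_prod_type' (f := fun i l => (2 : ℂ) ^ p * ((starRingEnd ℂ) (ψ i) *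
    (starRingEnd ℂ) (ψ l) * (ψ (S.piecewise l i) * ψ (S.piecewise i l))))]
  refine (norm_sum_le _ _).trans ?_
  calc _ ≤ ∑ q : (Fin n → Fin 2) × (Fin n → Fin 2), (2 : ℝ) ^ p *
        ((‖ψ q.1‖ ^ 2 * ‖ψ q.2‖ ^ 2 + ‖ψ (T q).1‖ ^ 2 * ‖ψ (T q).2‖ ^ 2) / 2) := by
        refine Finset.sum_le_sum fun q _ => ?_
        simp only [norm_mul, norm_pow, RCLike.norm_conj, T]
        rw [show ‖(2 : ℂ)‖ = 2 by simp]
        refine mul_le_mul_of_nonneg_left ?_ (by positivity)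
        nlinarith [sq_nonneg (‖ψ q.1‖ * ‖ψ q.2‖ -
          ‖ψ (S.piecewise q.2 q.1)‖ * ‖ψ (S.piecewise q.1 q.2)‖)]
    _ = 2 ^ p := by
        rw [← Finset.mul_sum, ← Finset.sum_div, Finset.sum_add_distrib, hA, hB]
        norm_num

lemma expc_prod (n : ℕ) (b : Fin n → Fin 4) (φ : Fin n → Fin 2 → ℂ) :
    expc (pauliString n b) (prodState n φ) = ∏ k, expc (pauli1 (b k)) (φ k) := by
  simp only [expc, pauliString, prodState, map_prod, ← Finset.prod_mul_distrib]
  rw [Fintype.prod_sum]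
  refine Finset.sum_congr rfl fun i _ => ?_
  rw [Fintype.prod_sum]

lemma expc_real (b : Fin 4) (v : Fin 2 → ℂ) : ((expc (pauli1 b) v).re : ℂ) = expc (pauli1 b) v := by
  apply Complex.ext
  · simp
  · fin_cases b <;> simp [expc, pauli1, PauliX, PauliY, PauliZ, Fin.sum_univ_two] <;> ring

lemma expc_sum (v : Fin 2 → ℂ) (hv : ∑ i, Complex.normSq (v i) = 1) :
    ∑ b, (expc (pauli1 b) v).re ^ 2 = 2 := by
  have : ∑ b, (expc (pauli1 b) v).re ^ 2 = 2 * (∑ i, Complex.normSq (v i)) ^ 2 := by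
    simp [expc, pauli1, PauliX, PauliY, PauliZ, Fin.sum_univ_two, Fin.sum_univ_four,
      Complex.normSq_apply]
    ring
  rw [this, hv]; norm_num

lemma expc_zero (v : Fin 2 → ℂ) (hv : ∑ i, Complex.normSq (v i) = 1) :
    (expc (pauli1 0) v).re ^ 2 = 1 := by
  have : (expc (pauli1 0) v).re = ∑ i, Complex.normSq (v i) := by
    simp [expc, pauli1, Fin.sum_univ_two, Complex.normSq_apply]
  rw [this, hv]; norm_num

lemma sum_prod_state (n p : ℕ) (f : Fin p → Fin n) (hf : Function.Injective f)
    (φ : Fin n → Fin 2 → ℂ) (hφ : ∀ k, ∑ i, Complex.normSq (φ k i) = 1) :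
    ∑ a, (expc (pauliString n (embedString4 n p f a)) (prodState n φ)).re ^ 2 = 2 ^ p := by
  have h1 : ∀ b : Fin n → Fin 4, (expc (pauliString n b) (prodState n φ)).re ^ 2 =
      ∏ k, (expc (pauli1 (b k)) (φ k)).re ^ 2 := by
    intro b
    rw [expc_prod, Finset.prod_pow]
    congr 1
    rw [← Complex.ofReal_re (∏ k, (expc (pauli1 (b k)) (φ k)).re), Complex.ofReal_prod]
    simp only [expc_real]
  simp only [h1]
  rw [sum_prod_embed n p f hf (fun k b => (expc (pauli1 b) (φ k)).re ^ 2)]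
  simp only [expc_sum _ (hφ _), expc_zero _ (hφ _)]
  rw [Finset.prod_ite_mem, Finset.univ_inter, Finset.prod_const,
    Finset.card_image_of_injective _ hf]
  simp

lemma second_moment (n p : ℕ) (Φ : (Fin n → Fin 2) → ℂ) :
    (∫ α : SpinIdx4 n p → ℝ, (energyAdj n p α Φ) ^ 2
        ∂(Measure.pi fun _ : SpinIdx4 n p => gaussianReal 0 1)) =
    (2 ^ p * (n.choose p : ℝ))⁻¹ *
      ∑ f : {f : Fin p → Fin n // ∀ i j : Fin p, i < j → f i < f j}, ∑ a,
        (expc (pauliString n (embedString4 n p f.1 a)) Φ).re ^ 2 := by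
  simp only [energy_eq]
  rw [gauss_second_moment]
  simp only [mul_pow, inv_pow]
  rw [Real.sq_sqrt (by positivity), ← Finset.mul_sum, Fintype.sum_prod_type]

/-- Product states maximize the variance of the adjusted model: for any product state `φ`
and any state `ψ`, `E[⟨ψ|H|ψ⟩²] ≤ E[⟨φ|H|φ⟩²] = 1`. -/
theorem product_states_maximize_adjusted_variance (n p : ℕ) (hp : 0 < p) (hpn : p ≤ n)
    (φ : Fin n → Fin 2 → ℂ) (hφ : ∀ k, ∑ i, Complex.normSq (φ k i) = 1)
    (ψ : (Fin n → Fin 2) → ℂ) (hψ : ∑ i, Complex.normSq (ψ i) = 1) :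
    (∫ α : SpinIdx4 n p → ℝ, (energyAdj n p α ψ) ^ 2
        ∂(Measure.pi fun _ : SpinIdx4 n p => gaussianReal 0 1))
      ≤ (∫ α : SpinIdx4 n p → ℝ, (energyAdj n p α (prodState n φ)) ^ 2
        ∂(Measure.pi fun _ : SpinIdx4 n p => gaussianReal 0 1)) ∧
    (∫ α : SpinIdx4 n p → ℝ, (energyAdj n p α (prodState n φ)) ^ 2
        ∂(Measure.pi fun _ : SpinIdx4 n p => gaussianReal 0 1)) = 1 := by
  have hc : (0 : ℝ) < n.choose p := by exact_mod_cast Nat.choose_pos hpn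
  have hinj : ∀ f : {f : Fin p → Fin n // ∀ i j : Fin p, i < j → f i < f j},
      Function.Injective f.1 := fun f =>
    (show StrictMono f.1 from fun i j h => f.2 i j h).injective
  have h1 : (∫ α : SpinIdx4 n p → ℝ, (energyAdj n p α (prodState n φ)) ^ 2
        ∂(Measure.pi fun _ : SpinIdx4 n p => gaussianReal 0 1)) = 1 := by
    rw [second_moment]
    simp only [sum_prod_state n p _ (hinj _) φ hφ]
    rw [Finset.sum_const, Finset.card_univ, card_mono, nsmul_eq_mul]
    field_simp
  refine ⟨?_, h1⟩
  rw [h1, second_moment]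
  have h2 : ∑ f : {f : Fin p → Fin n // ∀ i j : Fin p, i < j → f i < f j}, ∑ a,
      (expc (pauliString n (embedString4 n p f.1 a)) ψ).re ^ 2 ≤ n.choose p * 2 ^ p := by
    calc _ ≤ ∑ f : {f : Fin p → Fin n // ∀ i j : Fin p, i < j → f i < f j}, (2 : ℝ) ^ p := by
          refine Finset.sum_le_sum fun f _ => ?_
          refine le_trans (Finset.sum_le_sum fun a _ => ?_) (sum_normSq_le n p f.1 (hinj f) ψ hψ)
          rw [Complex.normSq_apply]
          nlinarith [mul_self_nonneg (expc (pauliString n (embedString4 n p f.1 a)) ψ).im]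
      _ = _ := by
          rw [Finset.sum_const, Finset.card_univ, card_mono, nsmul_eq_mul]
  rw [inv_mul_le_iff₀ (by positivity)]
  linarith
end
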